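/- Let q ∈ (0,1), let α ∈ ℝ, and let n ∈ ℤ≥0. Set s = q^{(2α+1)/4}. Then for all x ∈ ℂ: (1 − s e^{ix})(1 − s q^{1/2} e^{ix})(1 − s e^{−ix})(1 − s q^{1/2} e^{−ix}) · P_n^{(α+2)}(cos x | q) = q^{n+1/2}(1−q^{n+1})(1−q^{n+2}) · P_{n+2}^{(α)}(cos x | q) − q^{n}(1+q^{1/2})(1−q^{n+1})(1−q^{α+n+2}) · P_{n+1}^{(α)}(cos x | q) + q^{n}(1−q^{α+n+1})(1−q^{α+n+2}) · P_n^{(α)}(cos x | q). -/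

import Mathlib

open Complex Finset

/-- q-Pochhammer symbol `(a;q)_k = ∏_{j=0}^{k-1} (1 - a q^j)`. -/
noncomputable def qPoch (q a : ℂ) (k : ℕ) : ℂ := ∏ j ∈ Finset.range k, (1 - a * q ^ j)

/-- Continuous q-Laguerre polynomial `P_n^{(α)}(cos x | q)` as a function of `x ∈ ℂ`,
with `s = q^{(2α+1)/4}` (so the polynomial with parameter `α+2` uses
`q^{(2(α+2)+1)/4}` in place of `s`). -/
noncomputable def cqLPoly (q α : ℝ) (n : ℕ) (x : ℂ) : ℂ :=
  (qPoch (q : ℂ) (q : ℂ) n)⁻¹ * ∑ k ∈ Finset.range (n + 1),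
    qPoch (q : ℂ) ((q : ℂ) ^ (-(n : ℤ))) k *
      qPoch (q : ℂ) (((q ^ ((2 * α + 1) / 4) : ℝ) : ℂ) * Complex.exp (Complex.I * x)) k *
      qPoch (q : ℂ) (((q ^ ((2 * α + 1) / 4) : ℝ) : ℂ) * Complex.exp (-(Complex.I * x))) k *
      (q : ℂ) ^ k / qPoch (q : ℂ) (q : ℂ) k *
      qPoch (q : ℂ) (((q ^ (α + 1) : ℝ) : ℂ) * (q : ℂ) ^ k) (n - k)

lemma qPoch_succ (q a : ℂ) (k : ℕ) : qPoch q a (k + 1) = qPoch q a k * (1 - a * q ^ k) := by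
  simp [qPoch, Finset.prod_range_succ]

lemma qPoch_succ' (q a : ℂ) (k : ℕ) : qPoch q a (k + 1) = (1 - a) * qPoch q (a * q) k := by
  simp only [qPoch, Finset.prod_range_succ', pow_zero, mul_one]
  rw [mul_comm]
  congr 1
  refine Finset.prod_congr rfl fun j _ => ?_
  ring

/-- The coefficient `(q^{-n};q)_k q^k / (q;q)_k`. -/
noncomputable def hC (q : ℂ) (n k : ℕ) : ℂ :=
  qPoch q (q ^ (-(n : ℤ))) k * q ^ k / qPoch q q k

lemma hC_zero (q : ℂ) (n : ℕ) : hC q n 0 = 1 := by simp [hC, qPoch]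

lemma hC_big (q : ℂ) (hq : q ≠ 0) (n k : ℕ) (h : n < k) : hC q n k = 0 := by
  have : qPoch q (q ^ (-(n : ℤ))) k = 0 := by
    unfold qPoch
    refine Finset.prod_eq_zero (Finset.mem_range.2 h) ?_
    rw [zpow_neg, zpow_natCast, inv_mul_cancel₀ (pow_ne_zero _ hq), sub_self]
  rw [hC, this, zero_mul, zero_div]

lemma qq_ne (q : ℂ) (hq1 : ∀ k : ℕ, 1 - q ^ (k + 1) ≠ 0) (k : ℕ) : qPoch q q k ≠ 0 := by
  unfold qPoch
  refine Finset.prod_ne_zero_iff.2 fun j _ => ?_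
  have := hq1 j
  rwa [pow_succ'] at this

lemma hC_succ_right (q : ℂ) (hq : q ≠ 0) (hq1 : ∀ k : ℕ, 1 - q ^ (k + 1) ≠ 0) (n m : ℕ) :
    hC q n (m + 1) * (q ^ n * (1 - q ^ (m + 1))) = hC q n m * ((q ^ n - q ^ m) * q) := by
  have h1 := qq_ne q hq1 m
  have h2 := hq1 m
  have h3 := pow_ne_zero n hq
  have h4 : 1 - q * q ^ m ≠ 0 := by rwa [pow_succ'] at h2
  unfold hC
  rw [qPoch_succ, qPoch_succ, zpow_neg, zpow_natCast, pow_succ']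
  have h5 : 1 - q ^ m * q ≠ 0 := by rwa [mul_comm] at h4
  field_simp

lemma hC_succ_both (q : ℂ) (hq : q ≠ 0) (hq1 : ∀ k : ℕ, 1 - q ^ (k + 1) ≠ 0) (n m : ℕ) :
    hC q (n + 1) (m + 1) * (q ^ n * (1 - q ^ (m + 1))) = hC q n m * (q ^ (n + 1) - 1) := by
  have h1 := qq_ne q hq1 m
  have h2 := hq1 m
  have h3 := pow_ne_zero n hq
  have h4 : 1 - q * q ^ m ≠ 0 := by rwa [pow_succ'] at h2
  have e : q ^ (-((n + 1 : ℕ) : ℤ)) * q = q ^ (-(n : ℤ)) := by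
    rw [← zpow_add_one₀ hq]; congr 1; push_cast; ring
  unfold hC
  rw [qPoch_succ', e, qPoch_succ, zpow_neg, zpow_natCast]
  field_simp
  ring

lemma hC_I (q : ℂ) (hq : q ≠ 0) (hq1 : ∀ k : ℕ, 1 - q ^ (k + 1) ≠ 0) (n m : ℕ) :
    q ^ n * (hC q n (m + 1) - hC q (n + 1) (m + 1)) = hC q n m := by
  have a := hC_succ_right q hq hq1 n m
  have b := hC_succ_both q hq hq1 n m
  refine mul_right_cancel₀ (hq1 m) ?_
  linear_combination a - b

lemma hC_II (q : ℂ) (hq : q ≠ 0) (hq1 : ∀ k : ℕ, 1 - q ^ (k + 1) ≠ 0) (n m : ℕ) :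
    q ^ (m + 1) * hC q (n + 1) (m + 1) = hC q n (m + 1) - q * hC q n m := by
  have a := hC_succ_right q hq hq1 n m
  have b := hC_succ_both q hq hq1 n m
  refine mul_right_cancel₀ (mul_ne_zero (pow_ne_zero n hq) (hq1 m)) ?_
  linear_combination q ^ (m + 1) * b - a

/-- The unnormalised sum. -/
noncomputable def SS (q s A u v : ℂ) (n : ℕ) : ℂ :=
  ∑ k ∈ Finset.range (n + 1), hC q n k * (qPoch q (s * u) k * qPoch q (s * v) k) *
    qPoch q (A * q ^ k) (n - k)

lemma SS_ext (q s A u v : ℂ) (hq : q ≠ 0) (n j : ℕ) :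
    qPoch q (A * q ^ n) j * SS q s A u v n =
    ∑ k ∈ Finset.range (n + j + 1), hC q n k * (qPoch q (s * u) k * qPoch q (s * v) k) *
      qPoch q (A * q ^ k) (n + j - k) := by
  rw [show n + j + 1 = (n + 1) + j by ring, Finset.sum_range_add]
  rw [Finset.sum_eq_zero (s := Finset.range j), add_zero, SS, Finset.mul_sum]
  · refine Finset.sum_congr rfl fun k hk => ?_
    have hk : k ≤ n := by simpa [Nat.lt_succ_iff] using hk
    obtain ⟨i, rfl⟩ := Nat.exists_eq_add_of_le hk
    rw [show k + i - k = i by omega, show k + i + j - k = i + j by omega]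
    have : qPoch q (A * q ^ k) (i + j) =
        qPoch q (A * q ^ k) i * qPoch q (A * q ^ (k + i)) j := by
      simp only [qPoch, Finset.prod_range_add]
      congr 1
      refine Finset.prod_congr rfl fun l _ => ?_
      ring
    rw [this]; ring
  · intro k _
    rw [hC_big q hq n (n + 1 + k) (by omega)]
    ring

lemma key (q s t A u v : ℂ) (hq : q ≠ 0) (hq1 : ∀ k : ℕ, 1 - q ^ (k + 1) ≠ 0)
    (ht : t ^ 2 = q) (hA : s ^ 2 * t = A) (huv : u * v = 1) (n : ℕ) :
    (1 - s * u) * (1 - s * t * u) * (1 - s * v) * (1 - s * t * v) *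
      SS q (s * q) (A * q ^ 2) u v n =
    q ^ n * t * SS q s A u v (n + 2)
    - q ^ n * (1 + t) * (1 - A * q ^ (n + 1)) * SS q s A u v (n + 1)
    + q ^ n * (1 - A * q ^ n) * (1 - A * q ^ (n + 1)) * SS q s A u v n := by
  set F : ℕ → ℂ := fun k => (qPoch q (s * u) k * qPoch q (s * v) k) *
      qPoch q (A * q ^ k) (n + 2 - k) with hF
  have e2 : SS q s A u v (n + 2) = ∑ k ∈ Finset.range (n + 3), hC q (n + 2) k * F k := by
    simp only [SS, hF, mul_assoc]
  have e1 : (1 - A * q ^ (n + 1)) * SS q s A u v (n + 1) =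
      ∑ k ∈ Finset.range (n + 3), hC q (n + 1) k * F k := by
    have := SS_ext q s A u v hq (n + 1) 1
    simp only [hF, mul_assoc] at this ⊢
    rw [← this]; simp [qPoch]
  have e0 : (1 - A * q ^ n) * (1 - A * q ^ (n + 1)) * SS q s A u v n =
      ∑ k ∈ Finset.range (n + 3), hC q n k * F k := by
    have := SS_ext q s A u v hq n 2
    simp only [hF, mul_assoc] at this ⊢
    rw [← this]; simp [qPoch, Finset.prod_range_succ]; ring
  have eL : (1 - s * u) * (1 - s * t * u) * (1 - s * v) * (1 - s * t * v) *
      SS q (s * q) (A * q ^ 2) u v n =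
      ∑ k ∈ Finset.range (n + 1), (hC q n k * (t * (q ^ (k + 1))⁻¹) * F (k + 2) +
        hC q n k * (1 - t * (q ^ (k + 1))⁻¹) * F (k + 1)) := by
    rw [SS, Finset.mul_sum]
    refine Finset.sum_congr rfl fun k hk => ?_
    have hk : k ≤ n := by simpa [Nat.lt_succ_iff] using hk
    simp only [hF]
    rw [show n + 2 - (k + 2) = n - k by omega, show n + 2 - (k + 1) = (n - k) + 1 by omega,
      qPoch_succ' q (A * q ^ (k + 1)), show A * q ^ (k + 1) * q = A * q ^ (k + 2) by ring,
      show A * q ^ 2 * q ^ k = A * q ^ (k + 2) by ring,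
      show s * q * u = s * u * q by ring, show s * q * v = s * v * q by ring,
      qPoch_succ q (s * u) (k + 1), qPoch_succ q (s * v) (k + 1),
      qPoch_succ' q (s * u), qPoch_succ' q (s * v), ← hA]
    have hh : (1 - s * t * u) * (1 - s * t * v) = t * (q ^ (k + 1))⁻¹ *
        ((1 - s * u * q ^ (k + 1)) * (1 - s * v * q ^ (k + 1))) +
        (1 - t * (q ^ (k + 1))⁻¹) * (1 - s ^ 2 * t * q ^ (k + 1)) := by
      have := pow_ne_zero (k + 1) hq
      generalize q ^ (k + 1) = Q at *
      field_simp
      linear_combination (s ^ 2 * t ^ 2 * Q - s ^ 2 * t * Q ^ 2) * huv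
    generalize q ^ (k + 1) = Q at *
    linear_combination (1 - s * u) * (1 - s * v) * hC q n k * qPoch q (s * u * q) k *
      qPoch q (s * v * q) k * qPoch q (s ^ 2 * t * q ^ (k + 2)) (n - k) * hh
  have eR : q ^ n * t * SS q s A u v (n + 2)
    - q ^ n * (1 + t) * (1 - A * q ^ (n + 1)) * SS q s A u v (n + 1)
    + q ^ n * (1 - A * q ^ n) * (1 - A * q ^ (n + 1)) * SS q s A u v n =
      ∑ k ∈ Finset.range (n + 2), (hC q n k - t * q⁻¹ * hC q (n + 1) k) * F (k + 1) := by
    have : q ^ n * t * SS q s A u v (n + 2)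
      - q ^ n * (1 + t) * (1 - A * q ^ (n + 1)) * SS q s A u v (n + 1)
      + q ^ n * (1 - A * q ^ n) * (1 - A * q ^ (n + 1)) * SS q s A u v n =
      ∑ k ∈ Finset.range (n + 3), (q ^ n * t * (hC q (n + 2) k * F k)
        - q ^ n * (1 + t) * (hC q (n + 1) k * F k) + q ^ n * (hC q n k * F k)) := by
      rw [Finset.sum_add_distrib, Finset.sum_sub_distrib, ← Finset.mul_sum, ← Finset.mul_sum,
        ← Finset.mul_sum, ← e0, ← e1, ← e2]
      ring
    rw [this, Finset.sum_range_succ']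
    simp only [hC_zero]
    rw [show q ^ n * t * (1 * F 0) - q ^ n * (1 + t) * (1 * F 0) + q ^ n * (1 * F 0) = 0 by ring,
      add_zero]
    refine Finset.sum_congr rfl fun k _ => ?_
    have a := hC_I q hq hq1 n k
    have b := hC_I q hq hq1 (n + 1) k
    have b' : q ^ n * (hC q (n + 1) (k + 1) - hC q (n + 2) (k + 1)) = q⁻¹ * hC q (n + 1) k := by
      rw [← b]; field_simp; ring
    linear_combination F (k + 1) * a - t * F (k + 1) * b'
  rw [eL, eR, Finset.sum_add_distrib]
  have x1 : ∑ k ∈ Finset.range (n + 1), hC q n k * (1 - t * (q ^ (k + 1))⁻¹) * F (k + 1) =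
      ∑ k ∈ Finset.range (n + 2), hC q n k * (1 - t * (q ^ (k + 1))⁻¹) * F (k + 1) := by
    rw [Finset.sum_range_succ _ (n + 1), hC_big q hq n (n + 1) (by omega)]
    ring
  rw [x1, ← eq_sub_iff_add_eq, ← Finset.sum_sub_distrib, Finset.sum_range_succ' _ (n + 1)]
  simp only [hC_zero]
  rw [show ∀ S : ℂ, S + ((1 - t * q⁻¹ * 1) * F (0 + 1) -
    1 * (1 - t * (q ^ (0 + 1))⁻¹) * F (0 + 1)) = S by intro S; ring]
  refine Finset.sum_congr rfl fun k _ => ?_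
  have b := hC_II q hq hq1 n k
  have b' : q⁻¹ * hC q (n + 1) (k + 1) =
      (q ^ (k + 1 + 1))⁻¹ * hC q n (k + 1) - (q ^ (k + 1))⁻¹ * hC q n k := by
    have := pow_ne_zero k hq
    refine mul_left_cancel₀ (pow_ne_zero (k + 2) hq) ?_
    have l : q ^ (k + 2) * (q⁻¹ * hC q (n + 1) (k + 1)) = q ^ (k + 1) * hC q (n + 1) (k + 1) := by
      field_simp; ring
    rw [l, b]
    field_simp; ring
  linear_combination t * F (k + 2) * b'

lemma cqLPoly_eq (q α : ℝ) (n : ℕ) (x : ℂ) :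
    cqLPoly q α n x = (qPoch (q : ℂ) (q : ℂ) n)⁻¹ *
      SS q ((q ^ ((2 * α + 1) / 4) : ℝ) : ℂ) ((q ^ (α + 1) : ℝ) : ℂ)
        (Complex.exp (Complex.I * x)) (Complex.exp (-(Complex.I * x))) n := by
  unfold cqLPoly SS hC
  congr 1
  refine Finset.sum_congr rfl fun k _ => ?_
  ring

/-- The Christoffel relation (Theorem `thm:PhiPn` of the paper) for the continuous
q-Laguerre polynomials. -/
theorem continuous_q_laguerre_christoffel
    (q : ℝ) (hq0 : 0 < q) (hq1 : q < 1) (α : ℝ) (n : ℕ) (x : ℂ) :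
    (1 - ((q ^ ((2 * α + 1) / 4) : ℝ) : ℂ) * Complex.exp (Complex.I * x)) *
      (1 - ((q ^ ((2 * α + 1) / 4) : ℝ) : ℂ) * (Real.sqrt q : ℂ) * Complex.exp (Complex.I * x)) *
      (1 - ((q ^ ((2 * α + 1) / 4) : ℝ) : ℂ) * Complex.exp (-(Complex.I * x))) *
      (1 - ((q ^ ((2 * α + 1) / 4) : ℝ) : ℂ) * (Real.sqrt q : ℂ) *
        Complex.exp (-(Complex.I * x))) *
      cqLPoly q (α + 2) n x
    = (q : ℂ) ^ n * (Real.sqrt q : ℂ) * (1 - (q : ℂ) ^ (n + 1)) * (1 - (q : ℂ) ^ (n + 2)) *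
        cqLPoly q α (n + 2) x
      - (q : ℂ) ^ n * (1 + (Real.sqrt q : ℂ)) * (1 - (q : ℂ) ^ (n + 1)) *
          (1 - ((q ^ (α + (n : ℝ) + 2) : ℝ) : ℂ)) * cqLPoly q α (n + 1) x
      + (q : ℂ) ^ n * (1 - ((q ^ (α + (n : ℝ) + 1) : ℝ) : ℂ)) *
          (1 - ((q ^ (α + (n : ℝ) + 2) : ℝ) : ℂ)) * cqLPoly q α n x := by
  have hq : (q : ℂ) ≠ 0 := by exact_mod_cast hq0.ne'
  have hq' : ∀ k : ℕ, 1 - (q : ℂ) ^ (k + 1) ≠ 0 := by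
    intro k
    have : q ^ (k + 1) < 1 := pow_lt_one₀ hq0.le hq1 (by omega)
    have h2 : (1 - q ^ (k + 1) : ℝ) ≠ 0 := by linarith
    exact_mod_cast h2
  have ht : (Real.sqrt q : ℂ) ^ 2 = q := by exact_mod_cast Real.sq_sqrt hq0.le
  have hA : ((q ^ ((2 * α + 1) / 4) : ℝ) : ℂ) ^ 2 * (Real.sqrt q : ℂ) = ((q ^ (α + 1) : ℝ) : ℂ) := by
    have : (q ^ ((2 * α + 1) / 4)) ^ 2 * Real.sqrt q = q ^ (α + 1) := by
      rw [Real.sqrt_eq_rpow, pow_two, ← Real.rpow_add hq0, ← Real.rpow_add hq0]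
      congr 1; ring
    exact_mod_cast this
  have huv : Complex.exp (Complex.I * x) * Complex.exp (-(Complex.I * x)) = 1 := by
    rw [← Complex.exp_add, add_neg_cancel, Complex.exp_zero]
  have hs : ((q ^ ((2 * (α + 2) + 1) / 4) : ℝ) : ℂ) = ((q ^ ((2 * α + 1) / 4) : ℝ) : ℂ) * q := by
    have : q ^ ((2 * (α + 2) + 1) / 4) = q ^ ((2 * α + 1) / 4) * q := by
      rw [← Real.rpow_add_one hq0.ne']; congr 1; ring
    exact_mod_cast this
  have hA2 : ((q ^ (α + 2 + 1) : ℝ) : ℂ) = ((q ^ (α + 1) : ℝ) : ℂ) * (q : ℂ) ^ 2 := by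
    have : q ^ (α + 2 + 1) = q ^ (α + 1) * q ^ 2 := by
      rw [← Real.rpow_natCast, ← Real.rpow_add hq0]; congr 1; push_cast; ring
    exact_mod_cast this
  have hn2 : ((q ^ (α + (n : ℝ) + 2) : ℝ) : ℂ) = ((q ^ (α + 1) : ℝ) : ℂ) * (q : ℂ) ^ (n + 1) := by
    have : q ^ (α + (n : ℝ) + 2) = q ^ (α + 1) * q ^ (n + 1) := by
      rw [← Real.rpow_natCast, ← Real.rpow_add hq0]; congr 1; push_cast; ring
    exact_mod_cast this
  have hn1 : ((q ^ (α + (n : ℝ) + 1) : ℝ) : ℂ) = ((q ^ (α + 1) : ℝ) : ℂ) * (q : ℂ) ^ n := by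
    have : q ^ (α + (n : ℝ) + 1) = q ^ (α + 1) * q ^ n := by
      rw [← Real.rpow_natCast, ← Real.rpow_add hq0]; congr 1; ring
    exact_mod_cast this
  have K := key (q : ℂ) _ _ _ _ _ hq hq' ht hA huv n
  rw [cqLPoly_eq, cqLPoly_eq, cqLPoly_eq, cqLPoly_eq, hs, hA2, hn1, hn2]
  have g0 := qq_ne (q : ℂ) hq' n
  have p1 : (qPoch (q : ℂ) q (n + 1))⁻¹ * (1 - (q : ℂ) ^ (n + 1)) = (qPoch (q : ℂ) q n)⁻¹ := by
    have h := hq' n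
    rw [qPoch_succ, ← pow_succ']
    field_simp
  have p2 : (qPoch (q : ℂ) q (n + 2))⁻¹ * (1 - (q : ℂ) ^ (n + 2)) =
      (qPoch (q : ℂ) q (n + 1))⁻¹ := by
    have h := hq' (n + 1)
    have g1 := qq_ne (q : ℂ) hq' (n + 1)
    rw [qPoch_succ _ _ (n + 1), ← pow_succ']
    field_simp
  generalize SS (q : ℂ) _ _ _ _ (n + 2) = S2 at *
  generalize SS (q : ℂ) _ _ _ _ (n + 1) = S1 at *
  linear_combination (qPoch (q : ℂ) q n)⁻¹ * K
    - (q : ℂ) ^ n * (Real.sqrt q : ℂ) * S2 * ((1 - (q : ℂ) ^ (n + 1)) * p2 + p1)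
    + (q : ℂ) ^ n * (1 + (Real.sqrt q : ℂ)) *
      (1 - ((q ^ (α + 1) : ℝ) : ℂ) * (q : ℂ) ^ (n + 1)) * S1 * p1
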